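/- Corollary 1.3 (convergence of discrete gradients and of the Hamiltonian along policy iteration): Assume conditions (N2) and (N4), and let λ^h, Λ^h satisfy ν_h ≤ λ^h and 0 < λ^h ≤ Σ_i(t,x)+ν_h ≤ Λ^h for all i and (t,x). Set C_1 := 48 max{‖c‖²_∞, 2d‖f‖²_∞} and C_h := e^{C_1 T/λ^h}(12‖g‖²_∞ + Tλ^h). Then for every n ≥ 1 and every i ∈ {1,…,d}: sup_{(t,x) ∈ Ω^{τ,h}_T} |D_i^h(V_n^{τ,h} − V^{τ,h})(t,x)|² ≤ C_h h^{−2} 2^{1−n}, and sup_{(t,x) ∈ Ω^{τ,h}_T} |L(t,x, ∇^h V^{τ,h}(t,x))(α_n(t,x), β_n(t,x)) − H(t,x, ∇^h V^{τ,h}(t,x))|² ≤ 16 d C_h ‖f‖²_∞ h^{−2} 2^{1−n}. -/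

import Mathlib

open scoped BigOperators

noncomputable section

/-- Forward difference quotient `D_i^h φ(x) = (φ(x+h e_i) - φ(x))/h`. -/
def Dp {d : ℕ} (h : ℝ) (φ : (Fin d → ℝ) → ℝ) (x : Fin d → ℝ) (i : Fin d) : ℝ :=
  (φ (Function.update x i (x i + h)) - φ x) / h

/-- Backward difference quotient `D_{-i}^h φ(x) = (φ(x-h e_i) - φ(x))/h`. -/
def Dm {d : ℕ} (h : ℝ) (φ : (Fin d → ℝ) → ℝ) (x : Fin d → ℝ) (i : Fin d) : ℝ :=
  (φ (Function.update x i (x i - h)) - φ x) / h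

/-- Central difference gradient `∇^h`. -/
def cgrad {d : ℕ} (h : ℝ) (φ : (Fin d → ℝ) → ℝ) (x : Fin d → ℝ) : Fin d → ℝ :=
  fun i => (φ (Function.update x i (x i + h)) - φ (Function.update x i (x i - h))) / (2 * h)

/-- Discrete second difference `Δ_i^h`. -/
def lap1 {d : ℕ} (h : ℝ) (φ : (Fin d → ℝ) → ℝ) (x : Fin d → ℝ) (i : Fin d) : ℝ :=
  (φ (Function.update x i (x i + h)) - 2 * φ x + φ (Function.update x i (x i - h))) / h ^ 2

/-- Backward time difference quotient `∂_t^τ`. -/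
def dtT {d : ℕ} (τ : ℝ) (φ : ℝ → (Fin d → ℝ) → ℝ) (t : ℝ) (x : Fin d → ℝ) : ℝ :=
  (φ t x - φ (t - τ) x) / τ

/-- Euclidean norm of a vector in `Fin d → ℝ`. -/
def nrm {d : ℕ} (v : Fin d → ℝ) : ℝ := Real.sqrt (∑ i, v i ^ 2)

/-- The time grid `ℕ^τ_T = {0, τ, 2τ, …, T}`. -/
def timeGrid (τ T t : ℝ) : Prop := (∃ k : ℕ, t = k * τ) ∧ t ≤ T

/-- The space grid `ℤ^d_h = hℤ^d`. -/
def spaceGrid {d : ℕ} (h : ℝ) (x : Fin d → ℝ) : Prop := ∀ i, ∃ z : ℤ, x i = z * h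

/-- The running cost `L(t,x,p)(a,b) = c(t,x,a,b) + p · f(t,x,a,b)`. -/
def Lrun {d m₁ m₂ : ℕ} (c : ℝ → (Fin d → ℝ) → (Fin m₁ → ℝ) → (Fin m₂ → ℝ) → ℝ)
    (f : ℝ → (Fin d → ℝ) → (Fin m₁ → ℝ) → (Fin m₂ → ℝ) → Fin d → ℝ)
    (t : ℝ) (x p : Fin d → ℝ) (a : Fin m₁ → ℝ) (b : Fin m₂ → ℝ) : ℝ :=
  c t x a b + ∑ i, p i * f t x a b i

/-- The sup-inf (Isaacs) Hamiltonian `H(t,x,p) = max_{b ∈ B} min_{a ∈ A} L(t,x,p)(a,b)`. -/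
def Ham {d m₁ m₂ : ℕ} (A : Set (Fin m₁ → ℝ)) (B : Set (Fin m₂ → ℝ))
    (c : ℝ → (Fin d → ℝ) → (Fin m₁ → ℝ) → (Fin m₂ → ℝ) → ℝ)
    (f : ℝ → (Fin d → ℝ) → (Fin m₁ → ℝ) → (Fin m₂ → ℝ) → Fin d → ℝ)
    (t : ℝ) (x p : Fin d → ℝ) : ℝ :=
  sSup ((fun b => sInf ((fun a => Lrun c f t x p a b) '' A)) '' B)


def EE {d : ℕ} (τ h : ℝ) (a : Fin d → ℝ) (φ : (Fin d → ℝ) → ℝ) (x : Fin d → ℝ) : ℝ :=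
  φ x + τ / 2 * ∑ i, a i * lap1 h φ x i

def GG {d : ℕ} (h : ℝ) (a : Fin d → ℝ) (φ : (Fin d → ℝ) → ℝ) (x : Fin d → ℝ) : ℝ :=
  ∑ i, a i * (cgrad h φ x i) ^ 2

def SS {d : ℕ} (τ h C : ℝ) (a : ℕ → (Fin d → ℝ) → Fin d → ℝ) (u : ℕ → (Fin d → ℝ) → ℝ) :
    ℕ → (Fin d → ℝ) → ℝ
  | 0 => fun _ => 0
  | (k+1) => fun x => (1 + C) * EE τ h (a k x) (SS τ h C a u k) x + τ * GG h (a k x) (u k) x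

theorem spaceGrid_up {d : ℕ} {h : ℝ} {x : Fin d → ℝ} (hx : spaceGrid h x) (i : Fin d) :
    spaceGrid h (Function.update x i (x i + h)) := by
  intro j
  by_cases hj : j = i
  · subst hj
    obtain ⟨z, hz⟩ := hx j
    exact ⟨z + 1, by simp [hz]; ring⟩
  · simpa [Function.update_of_ne hj] using hx j

theorem spaceGrid_dn {d : ℕ} {h : ℝ} {x : Fin d → ℝ} (hx : spaceGrid h x) (i : Fin d) :
    spaceGrid h (Function.update x i (x i - h)) := by
  intro j
  by_cases hj : j = i
  · subst hj
    obtain ⟨z, hz⟩ := hx j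
    exact ⟨z - 1, by simp [hz]; ring⟩
  · simpa [Function.update_of_ne hj] using hx j

theorem EE_add {d : ℕ} (τ h : ℝ) (a : Fin d → ℝ) (φ ψ : (Fin d → ℝ) → ℝ) (r s : ℝ)
    (x : Fin d → ℝ) :
    EE τ h a (fun y => r * φ y + s * ψ y) x = r * EE τ h a φ x + s * EE τ h a ψ x := by
  have : ∑ i, a i * lap1 h (fun y => r * φ y + s * ψ y) x i
      = r * ∑ i, a i * lap1 h φ x i + s * ∑ i, a i * lap1 h ψ x i := by
    rw [Finset.mul_sum, Finset.mul_sum, ← Finset.sum_add_distrib]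
    refine Finset.sum_congr rfl fun i _ => ?_
    unfold lap1; ring
  unfold EE
  rw [this]; ring

theorem EE_const {d : ℕ} (τ h : ℝ) (a : Fin d → ℝ) (r : ℝ) (x : Fin d → ℝ) :
    EE τ h a (fun _ => r) x = r := by
  unfold EE lap1
  have : r - 2 * r + r = 0 := by ring
  simp [this]

theorem EE_form {d : ℕ} {τ h : ℝ} (hh : 0 < h) (a : Fin d → ℝ) (φ : (Fin d → ℝ) → ℝ)
    (x : Fin d → ℝ) :
    EE τ h a φ x = (1 - ∑ i, τ * a i / h ^ 2) * φ x
      + ∑ i, τ * a i / h ^ 2 * ((φ (Function.update x i (x i + h))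
          + φ (Function.update x i (x i - h))) / 2) := by
  unfold EE lap1
  rw [sub_mul, Finset.sum_mul, Finset.mul_sum, sub_add, ← Finset.sum_sub_distrib,
    one_mul, ← neg_neg (∑ i, τ / 2 * _), ← sub_eq_add_neg, ← Finset.sum_neg_distrib]
  congr 1
  refine Finset.sum_congr rfl fun i _ => ?_
  field_simp
  ring

theorem EE_mono {d : ℕ} {τ h : ℝ} (hτ : 0 < τ) (hh : 0 < h) (a : Fin d → ℝ)
    (ha : ∀ i, 0 ≤ a i) (hs : ∑ i, τ * a i / h ^ 2 ≤ 1) {φ ψ : (Fin d → ℝ) → ℝ}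
    (hφ : ∀ y, spaceGrid h y → φ y ≤ ψ y) {x : Fin d → ℝ} (hx : spaceGrid h x) :
    EE τ h a φ x ≤ EE τ h a ψ x := by
  rw [EE_form hh, EE_form hh]
  refine add_le_add (mul_le_mul_of_nonneg_left (hφ x hx) (by linarith)) ?_
  refine Finset.sum_le_sum fun i _ => ?_
  have := ha i
  have h1 := hφ _ (spaceGrid_up hx i)
  have h2 := hφ _ (spaceGrid_dn hx i)
  refine mul_le_mul_of_nonneg_left (by linarith) (by positivity)

theorem EE_var {d : ℕ} {τ h : ℝ} (hτ : 0 < τ) (hh : 0 < h) (a : Fin d → ℝ)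
    (ha : ∀ i, 0 ≤ a i) (hs : ∑ i, τ * a i / h ^ 2 ≤ 1) (φ : (Fin d → ℝ) → ℝ)
    (x : Fin d → ℝ) :
    (EE τ h a φ x) ^ 2 + τ * GG h a φ x ≤ EE τ h a (fun y => φ y ^ 2) x := by
  have key : ∀ (q m : Fin d → ℝ) (p : ℝ), (∀ i, 0 ≤ q i) → ∑ i, q i ≤ 1 →
      ((1 - ∑ i, q i) * p + ∑ i, q i * m i) ^ 2
        ≤ (1 - ∑ i, q i) * p ^ 2 + ∑ i, q i * m i ^ 2 := by
    intro q m p hq hq1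
    have e1 : ∑ i, q i * (m i - p) = ∑ i, q i * m i - (∑ i, q i) * p := by
      rw [Finset.sum_mul, ← Finset.sum_sub_distrib]
      exact Finset.sum_congr rfl fun i _ => by ring
    have e2 : ∑ i, q i * (m i - p) ^ 2
        = ∑ i, q i * m i ^ 2 - 2 * p * ∑ i, q i * m i + (∑ i, q i) * p ^ 2 := by
      rw [Finset.sum_mul, Finset.mul_sum, ← Finset.sum_sub_distrib, ← Finset.sum_add_distrib]
      exact Finset.sum_congr rfl fun i _ => by ring
    have cs : (∑ i, q i * (m i - p)) ^ 2 ≤ (∑ i, q i) * ∑ i, q i * (m i - p) ^ 2 := by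
      apply Finset.sum_sq_le_sum_mul_sum_of_sq_le_mul
      · intro i _; exact hq i
      · intro i _; have := hq i; positivity
      · intro i _; exact le_of_eq (by ring)
    have nn : 0 ≤ ∑ i, q i * (m i - p) ^ 2 :=
      Finset.sum_nonneg fun i _ => by have := hq i; positivity
    have cs2 : (∑ i, q i * (m i - p)) ^ 2 ≤ ∑ i, q i * (m i - p) ^ 2 := by nlinarith
    rw [e1, e2] at cs2
    nlinarith
  have := key (fun i => τ * a i / h ^ 2) (fun i => (φ (Function.update x i (x i + h))
          + φ (Function.update x i (x i - h))) / 2) (φ x)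
          (fun i => by have := ha i; positivity) hs
  rw [EE_form hh, EE_form hh]
  refine (add_le_add_left this _).trans (le_of_eq ?_)
  rw [add_assoc]
  congr 1
  unfold GG cgrad
  rw [Finset.mul_sum, ← Finset.sum_add_distrib]
  refine Finset.sum_congr rfl fun i _ => ?_
  field_simp
  ring

theorem GG_nonneg {d : ℕ} (h : ℝ) (a : Fin d → ℝ) (ha : ∀ i, 0 ≤ a i) (φ : (Fin d → ℝ) → ℝ)
    (x : Fin d → ℝ) : 0 ≤ GG h a φ x :=
  Finset.sum_nonneg fun i _ => by have := ha i; positivity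

theorem young {e F s P ε : ℝ} (hs : 0 ≤ s) (hP : 0 ≤ P) (hε : 0 < ε) (hF : F ^ 2 ≤ s * P) :
    2 * e * F ≤ s / ε * e ^ 2 + ε * P := by
  have h1 : 0 ≤ s / ε * e ^ 2 + ε * P := by positivity
  refine le_of_sq_le_sq ?_ h1
  have h2 : s / ε * e ^ 2 * (ε * P) = s * P * e ^ 2 := by field_simp
  have h3 := mul_le_mul_of_nonneg_right hF (sq_nonneg e)
  nlinarith [sq_nonneg (s / ε * e ^ 2 - ε * P)]

/-- one step -/
theorem one_step {e v X Γ F1 F2 τ s s2 P ε C Q : ℝ} (hτ : 0 < τ) (hv : v = e + τ * (F1 + F2))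
    (hX : e ^ 2 + τ * Γ ≤ X) (hs : 0 ≤ s) (hs2 : 0 ≤ s2) (hP : 0 ≤ P) (hε : 0 < ε)
    (hΓ : 0 ≤ Γ) (hF1 : F1 ^ 2 ≤ s * Γ) (hF1' : 2 * τ * F1 ^ 2 ≤ Γ / 96)
    (hF2 : F2 ^ 2 ≤ s2 * P) (hC0 : 0 ≤ C) (hC : τ * (3 * s + s2 / ε) ≤ C)
    (hQ : ε * P + 2 * τ * F2 ^ 2 ≤ Q) :
    v ^ 2 + 5 / 8 * (τ * Γ) ≤ (1 + C) * X + τ * Q := by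
  have y1 := young (e := e) hs hΓ (by norm_num : (0:ℝ) < 1/3) hF1
  have y2 := young (e := e) hs2 hP hε hF2
  have q : (F1 + F2) ^ 2 ≤ 2 * F1 ^ 2 + 2 * F2 ^ 2 := by nlinarith [sq_nonneg (F1 - F2)]
  have e1 : v ^ 2 = e ^ 2 + τ * (2 * e * F1 + 2 * e * F2 + τ * (F1 + F2) ^ 2) := by
    rw [hv]; ring
  have i1 : 2 * e * F1 + 2 * e * F2 + τ * (F1 + F2) ^ 2
      ≤ (3 * s + s2 / ε) * e ^ 2 + (1/3 + 1/96) * Γ + Q := by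
    have := mul_le_mul_of_nonneg_left q hτ.le
    have h3 : s / (1/3) = 3 * s := by ring
    rw [h3] at y1
    nlinarith
  have i2 := mul_le_mul_of_nonneg_left i1 hτ.le
  have i3 := mul_le_mul_of_nonneg_right hC (sq_nonneg e)
  have i4 : 0 ≤ τ * Γ := by positivity
  have i5 : (1 + C) * (e ^ 2 + τ * Γ) ≤ (1 + C) * X :=
    mul_le_mul_of_nonneg_left hX (by linarith)
  have i6 : 0 ≤ C * (τ * Γ) := by positivity
  nlinarith

theorem comparison {d N : ℕ} {τ h C : ℝ} (hτ : 0 < τ) (hh : 0 < h) (hC : 0 ≤ C)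
    (a : ℕ → (Fin d → ℝ) → Fin d → ℝ)
    (ha : ∀ k x i, 0 ≤ a k x i) (hs : ∀ k x, ∑ i, τ * a k x i / h ^ 2 ≤ 1)
    (y z : ℕ → (Fin d → ℝ) → ℝ) (Q : ℕ → (Fin d → ℝ) → ℝ)
    (h0 : ∀ x, spaceGrid h x → y 0 x ≤ z 0 x)
    (hy : ∀ k x, k < N → spaceGrid h x →
      y (k+1) x ≤ (1 + C) * EE τ h (a k x) (y k) x + Q k x)
    (hz : ∀ k x, k < N → spaceGrid h x →
      (1 + C) * EE τ h (a k x) (z k) x + Q k x ≤ z (k+1) x) :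
    ∀ k, k ≤ N → ∀ x, spaceGrid h x → y k x ≤ z k x := by
  intro k
  induction k with
  | zero => intro _; exact h0
  | succ k ih =>
    intro hk x hx
    refine (hy k x hk hx).trans (le_trans ?_ (hz k x hk hx))
    have := EE_mono hτ hh (a k x) (ha k x) (hs k x) (ih (by omega)) hx
    have := mul_le_mul_of_nonneg_left this (by linarith : 0 ≤ 1 + C)
    linarith

theorem dot_sq {d : ℕ} {Mf : ℝ} (p v : Fin d → ℝ) (hv : nrm v ≤ Mf) :
    (∑ i, p i * v i) ^ 2 ≤ Mf ^ 2 * ∑ i, p i ^ 2 := by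
  have h0 : 0 ≤ ∑ i, v i ^ 2 := Finset.sum_nonneg fun i _ => sq_nonneg _
  have h1 : ∑ i, v i ^ 2 ≤ Mf ^ 2 := by
    rw [← Real.sq_sqrt h0]
    exact pow_le_pow_left₀ (Real.sqrt_nonneg _) hv 2
  have h2 := Finset.sum_mul_sq_le_sq_mul_sq Finset.univ p v
  have h3 : 0 ≤ ∑ i, p i ^ 2 := Finset.sum_nonneg fun i _ => sq_nonneg _
  nlinarith

theorem supinf_le {α β : Type*} {A : Set α} {B : Set β} (hA : A.Nonempty) (hB : B.Nonempty)
    (L1 L2 : α → β → ℝ) (K δ : ℝ)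
    (h1 : ∀ a b, |L1 a b| ≤ K) (h2 : ∀ a b, |L2 a b| ≤ K)
    (h : ∀ a b, L1 a b ≤ L2 a b + δ) :
    sSup ((fun b => sInf ((fun a => L1 a b) '' A)) '' B)
      ≤ sSup ((fun b => sInf ((fun a => L2 a b) '' A)) '' B) + δ := by
  have bdd : ∀ (L : α → β → ℝ), (∀ a b, |L a b| ≤ K) → ∀ b, BddBelow ((fun a => L a b) '' A) := by
    intro L hL b
    refine ⟨-K, ?_⟩
    rintro _ ⟨a, _, rfl⟩
    exact (abs_le.1 (hL a b)).1
  obtain ⟨a0, ha0⟩ := hA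
  have bda : BddAbove ((fun b => sInf ((fun a => L2 a b) '' A)) '' B) := by
    refine ⟨K, ?_⟩
    rintro _ ⟨b, _, rfl⟩
    exact (csInf_le (bdd L2 h2 b) ⟨a0, ha0, rfl⟩).trans (abs_le.1 (h2 a0 b)).2
  apply csSup_le (hB.image _)
  rintro _ ⟨b, hb, rfl⟩
  have e1 := le_csSup bda ⟨b, hb, rfl⟩
  have e2 : sInf ((fun a => L1 a b) '' A) - δ ≤ sInf ((fun a => L2 a b) '' A) := by
    apply le_csInf (Set.Nonempty.image _ ⟨a0, ha0⟩)
    rintro _ ⟨a, ha, rfl⟩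
    have := csInf_le (bdd L1 h1 b) ⟨a, ha, rfl⟩
    have := h a b
    simp only at *
    linarith
  simp only at *
  linarith

theorem split_abs {F K1 K2 : ℝ} (h1 : 0 ≤ K1) (h : |F| ≤ K1 + K2) :
    ∃ F1 F2, F = F1 + F2 ∧ F1 ^ 2 ≤ K1 ^ 2 ∧ F2 ^ 2 ≤ K2 ^ 2 := by
  rw [abs_le] at h
  rcases le_total F (-K2) with hF | hF
  · exact ⟨F + K2, -K2, by ring, by nlinarith, by nlinarith⟩
  · rcases le_total F K2 with hF' | hF'
    · exact ⟨0, F, by ring, by nlinarith, by nlinarith⟩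
    · exact ⟨F - K2, K2, by ring, by nlinarith, by nlinarith⟩

theorem GG_lower {d : ℕ} {h m : ℝ} (a : Fin d → ℝ) (ha : ∀ i, m ≤ a i) (φ : (Fin d → ℝ) → ℝ)
    (x : Fin d → ℝ) : m * ∑ i, (cgrad h φ x i) ^ 2 ≤ GG h a φ x := by
  unfold GG
  rw [Finset.mul_sum]
  exact Finset.sum_le_sum fun i _ => mul_le_mul_of_nonneg_right (ha i) (sq_nonneg _)

theorem basic_bound {d N : ℕ} {τ h lam Mc Mf Mg M : ℝ} (hτ : 0 < τ) (hh : 0 < h) (hlam : 0 < lam)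
    (hM1 : Mc ^ 2 ≤ M) (hM2 : 2 * Mf ^ 2 ≤ M)
    (a : ℕ → (Fin d → ℝ) → Fin d → ℝ)
    (ha : ∀ k x i, lam ≤ a k x i) (ha2 : ∀ k x i, 192 * τ * Mf ^ 2 ≤ a k x i)
    (hs : ∀ k x, ∑ i, τ * a k x i / h ^ 2 ≤ 1)
    (u : ℕ → (Fin d → ℝ) → ℝ) (h0 : ∀ x, spaceGrid h x → u 0 x ^ 2 ≤ Mg ^ 2)
    (hu : ∀ k x, k < N → spaceGrid h x → ∃ F1 F2, u (k+1) x = EE τ h (a k x) (u k) x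
      + τ * (F1 + F2) ∧ F1 ^ 2 ≤ Mf ^ 2 * ∑ i, (cgrad h (u k) x i) ^ 2 ∧ F2 ^ 2 ≤ Mc ^ 2) :
    ∀ k, k ≤ N → ∀ x, spaceGrid h x →
      1 * u k x ^ 2 + 5 / 8 * SS τ h (τ * (24 * M / lam)) a u k x
        ≤ (1 + τ * (24 * M / lam)) ^ k * (Mg ^ 2 + k * τ * (lam / 20 + 2 * τ * Mc ^ 2)) := by
  have hM0 : 0 ≤ M := (sq_nonneg _).trans hM1
  have hC : 0 ≤ τ * (24 * M / lam) := by positivity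
  refine comparison hτ hh hC a (fun k x i => hlam.le.trans (ha k x i)) hs
    (fun k x => 1 * u k x ^ 2 + 5 / 8 * SS τ h (τ * (24 * M / lam)) a u k x)
    (fun k x => (1 + τ * (24 * M / lam)) ^ k * (Mg ^ 2 + k * τ * (lam / 20 + 2 * τ * Mc ^ 2)))
    (fun k x => τ * (lam / 20 + 2 * τ * Mc ^ 2)) ?_ ?_ ?_
  · intro x hx
    simpa [SS] using h0 x hx
  · intro k x hk hx
    obtain ⟨F1, F2, e, b1, b2⟩ := hu k x hk hx
    have ha0 : ∀ i, 0 ≤ a k x i := fun i => hlam.le.trans (ha k x i)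
    have g1 := GG_lower (h := h) (a k x) (ha k x) (u k) x
    have g2 := GG_lower (h := h) (a k x) (ha2 k x) (u k) x
    have := one_step (s := Mf ^ 2 / lam) (s2 := Mc ^ 2 / lam) (P := lam) (ε := 1 / 20)
      (C := τ * (24 * M / lam)) (Q := lam / 20 + 2 * τ * Mc ^ 2) hτ e
      (EE_var hτ hh (a k x) ha0 (hs k x) (u k) x) (by positivity) (by positivity) hlam.le
      (by norm_num) (GG_nonneg h _ ha0 _ _) ?_ ?_ ?_ hC ?_ ?_
    · rw [EE_add τ h (a k x) (fun y => u k y ^ 2)]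
      simp only [SS]
      linarith
    · refine b1.trans ?_
      rw [div_mul_eq_mul_div, mul_div_assoc]
      refine mul_le_mul_of_nonneg_left ?_ (sq_nonneg _)
      rw [le_div_iff₀ hlam]; linarith
    · have := mul_le_mul_of_nonneg_left b1 hτ.le
      linarith
    · rw [div_mul_cancel₀ _ hlam.ne']; exact b2
    · refine mul_le_mul_of_nonneg_left ?_ hτ.le
      have : 3 * (Mf ^ 2 / lam) + Mc ^ 2 / lam / (1 / 20) = (3 * Mf ^ 2 + 20 * Mc ^ 2) / lam := by
        field_simp
      rw [this]
      exact div_le_div_of_nonneg_right (by linarith) hlam.le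
    · have := mul_le_mul_of_nonneg_left b2 hτ.le
      linarith
  · intro k x hk hx
    rw [EE_const, ← mul_assoc, ← pow_succ']
    have h1 : (1:ℝ) ≤ (1 + τ * (24 * M / lam)) ^ (k+1) := one_le_pow₀ (by linarith)
    have h2 : 0 ≤ τ * (lam / 20 + 2 * τ * Mc ^ 2) := by positivity
    push_cast
    nlinarith [mul_le_mul_of_nonneg_right h1 h2]

theorem step_bound {d N : ℕ} {τ h lam Mf M : ℝ} (hτ : 0 < τ) (hh : 0 < h) (hlam : 0 < lam)
    (hM2 : 2 * Mf ^ 2 ≤ M)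
    (a : ℕ → (Fin d → ℝ) → Fin d → ℝ)
    (ha : ∀ k x i, lam ≤ a k x i) (ha2 : ∀ k x i, 192 * τ * Mf ^ 2 ≤ a k x i)
    (hs : ∀ k x, ∑ i, τ * a k x i / h ^ 2 ≤ 1)
    (u w : ℕ → (Fin d → ℝ) → ℝ) (h0 : ∀ x, spaceGrid h x → u 0 x = 0)
    (hu : ∀ k x, k < N → spaceGrid h x → ∃ F1 F2, u (k+1) x = EE τ h (a k x) (u k) x
      + τ * (F1 + F2) ∧ F1 ^ 2 ≤ Mf ^ 2 * ∑ i, (cgrad h (u k) x i) ^ 2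
      ∧ F2 ^ 2 ≤ 4 * (Mf ^ 2 * ∑ i, (cgrad h (w k) x i) ^ 2)) :
    ∀ k, k ≤ N → ∀ x, spaceGrid h x →
      1 * u k x ^ 2 + 5 / 8 * SS τ h (τ * (24 * M / lam)) a u k x
        ≤ 5 / 16 * SS τ h (τ * (24 * M / lam)) a w k x + 0 * 0 := by
  have hM0 : 0 ≤ M := le_trans (by positivity) hM2
  have hC : 0 ≤ τ * (24 * M / lam) := by positivity
  refine comparison hτ hh hC a (fun k x i => hlam.le.trans (ha k x i)) hs
    (fun k x => 1 * u k x ^ 2 + 5 / 8 * SS τ h (τ * (24 * M / lam)) a u k x)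
    (fun k x => 5 / 16 * SS τ h (τ * (24 * M / lam)) a w k x + 0 * 0)
    (fun k x => τ * (5 / 16 * GG h (a k x) (w k) x)) ?_ ?_ ?_
  · intro x hx
    simp [SS, h0 x hx]
  · intro k x hk hx
    obtain ⟨F1, F2, e, b1, b2⟩ := hu k x hk hx
    have ha0 : ∀ i, 0 ≤ a k x i := fun i => hlam.le.trans (ha k x i)
    have g1 := GG_lower (h := h) (a k x) (ha k x) (u k) x
    have g2 := GG_lower (h := h) (a k x) (ha2 k x) (u k) x
    have g3 := GG_lower (h := h) (a k x) (ha k x) (w k) x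
    have g4 := GG_lower (h := h) (a k x) (ha2 k x) (w k) x
    have gn := GG_nonneg h _ ha0 (w k) x
    have := one_step (s := Mf ^ 2 / lam) (s2 := 4 * Mf ^ 2 / lam) (P := GG h (a k x) (w k) x)
      (ε := 1 / 4)
      (C := τ * (24 * M / lam)) (Q := 5 / 16 * GG h (a k x) (w k) x) hτ e
      (EE_var hτ hh (a k x) ha0 (hs k x) (u k) x) (by positivity) (by positivity) gn
      (by norm_num) (GG_nonneg h _ ha0 _ _) ?_ ?_ ?_ hC ?_ ?_
    · rw [EE_add τ h (a k x) (fun y => u k y ^ 2)]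
      simp only [SS]
      linarith
    · refine b1.trans ?_
      rw [div_mul_eq_mul_div, mul_div_assoc]
      refine mul_le_mul_of_nonneg_left ?_ (sq_nonneg _)
      rw [le_div_iff₀ hlam]; linarith
    · have := mul_le_mul_of_nonneg_left b1 hτ.le
      linarith
    · refine b2.trans ?_
      rw [div_mul_eq_mul_div, mul_div_assoc, ← mul_assoc]
      refine mul_le_mul_of_nonneg_left ?_ (by positivity)
      rw [le_div_iff₀ hlam]; linarith
    · refine mul_le_mul_of_nonneg_left ?_ hτ.le
      have : 3 * (Mf ^ 2 / lam) + 4 * Mf ^ 2 / lam / (1 / 4) = (19 * Mf ^ 2) / lam := by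
        field_simp; ring
      rw [this]
      exact div_le_div_of_nonneg_right (by linarith) hlam.le
    · have := mul_le_mul_of_nonneg_left b2 hτ.le
      linarith
  · intro k x hk hx
    have := EE_add τ h (a k x) (SS τ h (τ * (24 * M / lam)) a w k) (fun _ => 0) (5/16) 0 x
    simp only [mul_zero, add_zero, zero_mul] at this ⊢
    rw [this]
    simp only [SS]
    linarith

theorem SS_sub {d N : ℕ} {τ h C : ℝ} (hτ : 0 < τ) (hh : 0 < h) (hC : 0 ≤ C)
    (a : ℕ → (Fin d → ℝ) → Fin d → ℝ)
    (ha : ∀ k x i, 0 ≤ a k x i) (hs : ∀ k x, ∑ i, τ * a k x i / h ^ 2 ≤ 1)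
    (u v : ℕ → (Fin d → ℝ) → ℝ) :
    ∀ k, k ≤ N → ∀ x, spaceGrid h x →
      SS τ h C a (fun k y => u k y - v k y) k x ≤ 2 * SS τ h C a u k x + 2 * SS τ h C a v k x := by
  refine comparison hτ hh hC a ha hs _ (fun k x => 2 * SS τ h C a u k x + 2 * SS τ h C a v k x)
    (fun k x => τ * (GG h (a k x) (fun y => u k y - v k y) x)) ?_ ?_ ?_
  · intro x hx; simp [SS]
  · intro k x hk hx
    simp only [SS]; exact le_rfl
  · intro k x hk hx
    rw [EE_add]
    have : GG h (a k x) (fun y => u k y - v k y) x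
        ≤ 2 * GG h (a k x) (u k) x + 2 * GG h (a k x) (v k) x := by
      unfold GG
      rw [Finset.mul_sum, Finset.mul_sum, ← Finset.sum_add_distrib]
      refine Finset.sum_le_sum fun i _ => ?_
      have e : cgrad h (fun y => u k y - v k y) x i = cgrad h (u k) x i - cgrad h (v k) x i := by
        unfold cgrad; ring
      rw [e]
      have := mul_nonneg (ha k x i) (sq_nonneg (cgrad h (u k) x i + cgrad h (v k) x i))
      nlinarith
    have := mul_le_mul_of_nonneg_left this hτ.le
    simp only [SS]
    linarith

theorem SS_nonneg {d N : ℕ} {τ h C : ℝ} (hτ : 0 < τ) (hh : 0 < h) (hC : 0 ≤ C)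
    (a : ℕ → (Fin d → ℝ) → Fin d → ℝ)
    (ha : ∀ k x i, 0 ≤ a k x i) (hs : ∀ k x, ∑ i, τ * a k x i / h ^ 2 ≤ 1)
    (u : ℕ → (Fin d → ℝ) → ℝ) :
    ∀ k, k ≤ N → ∀ x, spaceGrid h x → 0 ≤ SS τ h C a u k x := by
  refine comparison hτ hh hC a ha hs (fun _ _ => 0) _
    (fun k x => τ * (GG h (a k x) (u k) x)) ?_ ?_ ?_
  · intro x hx; simp [SS]
  · intro k x hk hx
    rw [EE_const]
    have := GG_nonneg h _ (ha k x) (u k) x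
    positivity
  · intro k x hk hx
    simp only [SS]; exact le_rfl

/-- final constant -/
theorem const_bound {N k : ℕ} {τ T lam Mc Mg M : ℝ} (hτ : 0 < τ) (hlam : 0 < lam) (hk : k ≤ N)
    (hT : T = N * τ) (hT0 : 0 < T) (hM1 : Mc ^ 2 ≤ M) :
    8 * ((1 + τ * (24 * M / lam)) ^ k * (Mg ^ 2 + k * τ * (lam / 20 + 2 * τ * Mc ^ 2)))
      ≤ Real.exp (48 * M * T / lam) * (12 * Mg ^ 2 + T * lam) := by
  have hM0 : 0 ≤ M := (sq_nonneg _).trans hM1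
  have hkT : k * τ ≤ T := by
    rw [hT]; exact mul_le_mul_of_nonneg_right (by exact_mod_cast hk) hτ.le
  have hτT : τ ≤ T := by
    rcases Nat.eq_zero_or_pos N with h | h
    · subst h; simp at hT; linarith
    · have : (1:ℝ) ≤ N := by exact_mod_cast h
      rw [hT]; nlinarith
  have hz : 0 ≤ 24 * M * T / lam := by positivity
  have h1 : (1 + τ * (24 * M / lam)) ^ k ≤ Real.exp (24 * M * T / lam) := by
    calc (1 + τ * (24 * M / lam)) ^ k ≤ (Real.exp (τ * (24 * M / lam))) ^ k := by
          refine pow_le_pow_left₀ (by positivity) ?_ _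
          linarith [Real.add_one_le_exp (τ * (24 * M / lam))]
      _ = Real.exp ((k * τ) * (24 * M / lam)) := by rw [← Real.exp_nat_mul]; ring_nf
      _ ≤ _ := by
          apply Real.exp_le_exp.2
          have := mul_le_mul_of_nonneg_right hkT (by positivity : 0 ≤ 24 * M / lam)
          refine this.trans (le_of_eq (by ring))
  have h2 : Real.exp (48 * M * T / lam)
      = Real.exp (24 * M * T / lam) * Real.exp (24 * M * T / lam) := by
    rw [← Real.exp_add]; ring_nf
  have h3 := Real.add_one_le_exp (24 * M * T / lam)
  have h4 : 8 * (Mg ^ 2 + k * τ * (lam / 20 + 2 * τ * Mc ^ 2))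
      ≤ Real.exp (24 * M * T / lam) * (12 * Mg ^ 2 + T * lam) := by
    have e1 : (24 * M * T / lam + 1) * (12 * Mg ^ 2 + T * lam)
        = (24 * M * T / lam) * (12 * Mg ^ 2) + 12 * Mg ^ 2 + T * (24 * M * T + lam) := by
      field_simp
    have e2 := mul_le_mul_of_nonneg_right h3 (by positivity : 0 ≤ 12 * Mg ^ 2 + T * lam)
    have e3 : k * τ * (lam / 20 + 2 * τ * Mc ^ 2) ≤ T * (lam / 20 + 2 * (T * M)) := by
      have := mul_le_mul hτT hM1 (sq_nonneg _) hT0.le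
      exact mul_le_mul hkT (by linarith) (by positivity) hT0.le
    have e4 : 0 ≤ (24 * M * T / lam) * (12 * Mg ^ 2) := by positivity
    have e5 : 0 ≤ T * lam := by positivity
    have e6 : 0 ≤ T * (T * M) := by positivity
    nlinarith [sq_nonneg Mg]
  rw [h2, mul_assoc (Real.exp _) (Real.exp _)]
  calc _ = (1 + τ * (24 * M / lam)) ^ k
        * (8 * (Mg ^ 2 + k * τ * (lam / 20 + 2 * τ * Mc ^ 2))) := by ring
    _ ≤ _ := mul_le_mul h1 h4 (by positivity) (Real.exp_pos _).le

theorem L_diff {d m₁ m₂ : ℕ} (c : ℝ → (Fin d → ℝ) → (Fin m₁ → ℝ) → (Fin m₂ → ℝ) → ℝ)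
    (f : ℝ → (Fin d → ℝ) → (Fin m₁ → ℝ) → (Fin m₂ → ℝ) → Fin d → ℝ) {Mf : ℝ}
    (hMf : ∀ t x a b, nrm (f t x a b) ≤ Mf) (t : ℝ) (x p q : Fin d → ℝ)
    (a : Fin m₁ → ℝ) (b : Fin m₂ → ℝ) :
    |Lrun c f t x p a b - Lrun c f t x q a b| ≤ Real.sqrt (Mf ^ 2 * ∑ i, (p i - q i) ^ 2) := by
  apply Real.abs_le_sqrt
  have := dot_sq (fun i => p i - q i) (f t x a b) (hMf t x a b)
  refine le_trans (le_of_eq ?_) this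
  congr 1
  unfold Lrun
  rw [add_sub_add_left_eq_sub, ← Finset.sum_sub_distrib]
  exact Finset.sum_congr rfl fun i _ => by ring

theorem L_abs {d m₁ m₂ : ℕ} (c : ℝ → (Fin d → ℝ) → (Fin m₁ → ℝ) → (Fin m₂ → ℝ) → ℝ)
    (f : ℝ → (Fin d → ℝ) → (Fin m₁ → ℝ) → (Fin m₂ → ℝ) → Fin d → ℝ) {Mc Mf : ℝ}
    (hMc : ∀ t x a b, |c t x a b| ≤ Mc)
    (hMf : ∀ t x a b, nrm (f t x a b) ≤ Mf) (t : ℝ) (x p : Fin d → ℝ)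
    (a : Fin m₁ → ℝ) (b : Fin m₂ → ℝ) :
    |Lrun c f t x p a b| ≤ Real.sqrt (Mf ^ 2 * ∑ i, (p i) ^ 2) + Mc := by
  have h1 := Real.abs_le_sqrt (dot_sq p (f t x a b) (hMf t x a b))
  have h2 := hMc t x a b
  unfold Lrun
  have := abs_add_le (c t x a b) (∑ i, p i * f t x a b i)
  linarith

theorem Ham_diff {d m₁ m₂ : ℕ} {A : Set (Fin m₁ → ℝ)} {B : Set (Fin m₂ → ℝ)}
    (hA : A.Nonempty) (hB : B.Nonempty)
    (c : ℝ → (Fin d → ℝ) → (Fin m₁ → ℝ) → (Fin m₂ → ℝ) → ℝ)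
    (f : ℝ → (Fin d → ℝ) → (Fin m₁ → ℝ) → (Fin m₂ → ℝ) → Fin d → ℝ) {Mc Mf : ℝ}
    (hMc : ∀ t x a b, |c t x a b| ≤ Mc)
    (hMf : ∀ t x a b, nrm (f t x a b) ≤ Mf) (t : ℝ) (x p q : Fin d → ℝ) :
    |Ham A B c f t x p - Ham A B c f t x q| ≤ Real.sqrt (Mf ^ 2 * ∑ i, (p i - q i) ^ 2) := by
  have key : ∀ a b, _ := L_diff c f hMf t x p q
  have kp : ∀ a b, _ := L_abs c f hMc hMf t x p
  have kq : ∀ a b, _ := L_abs c f hMc hMf t x q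
  have n1 := Real.sqrt_nonneg (Mf ^ 2 * ∑ i, (p i) ^ 2)
  have n2 := Real.sqrt_nonneg (Mf ^ 2 * ∑ i, (q i) ^ 2)
  set K := Real.sqrt (Mf ^ 2 * ∑ i, (p i) ^ 2) + Real.sqrt (Mf ^ 2 * ∑ i, (q i) ^ 2) + Mc
  have kp' : ∀ a b, |Lrun c f t x p a b| ≤ K := fun a b => (kp a b).trans (by simp only [K]; linarith)
  have kq' : ∀ a b, |Lrun c f t x q a b| ≤ K := fun a b => (kq a b).trans (by simp only [K]; linarith)
  have r1 := supinf_le hA hB (Lrun c f t x p) (Lrun c f t x q) K _ kp' kq'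
    (fun a b => by have := (abs_le.1 (key a b)).2; exact sub_le_iff_le_add'.1 this)
  have r2 := supinf_le hA hB (Lrun c f t x q) (Lrun c f t x p) K
    (Real.sqrt (Mf ^ 2 * ∑ i, (p i - q i) ^ 2)) kq' kp'
    (fun a b => by have := (abs_le.1 (key a b)).1; linarith)
  rw [abs_le]
  unfold Ham
  constructor <;> linarith

theorem Ham_abs {d m₁ m₂ : ℕ} {A : Set (Fin m₁ → ℝ)} {B : Set (Fin m₂ → ℝ)}
    (hA : A.Nonempty) (hB : B.Nonempty)
    (c : ℝ → (Fin d → ℝ) → (Fin m₁ → ℝ) → (Fin m₂ → ℝ) → ℝ)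
    (f : ℝ → (Fin d → ℝ) → (Fin m₁ → ℝ) → (Fin m₂ → ℝ) → Fin d → ℝ) {Mc Mf : ℝ}
    (hMc : ∀ t x a b, |c t x a b| ≤ Mc)
    (hMf : ∀ t x a b, nrm (f t x a b) ≤ Mf) (t : ℝ) (x p : Fin d → ℝ) :
    |Ham A B c f t x p| ≤ Real.sqrt (Mf ^ 2 * ∑ i, (p i) ^ 2) + Mc := by
  have key : ∀ a b, _ := L_abs c f hMc hMf t x p
  have hK : 0 ≤ Real.sqrt (Mf ^ 2 * ∑ i, (p i) ^ 2) + Mc := by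
    obtain ⟨a, _⟩ := hA
    obtain ⟨b, _⟩ := hB
    exact (abs_nonneg _).trans (key a b)
  have r1 := supinf_le hA hB (Lrun c f t x p) (fun _ _ => 0) _ _ key (fun _ _ => by simpa using hK)
    (fun a b => by have := (abs_le.1 (key a b)).2; simpa using this)
  have r2 := supinf_le hA hB (fun _ _ => 0) (Lrun c f t x p) _ _ (fun _ _ => by simpa using hK) key
    (fun a b => by have := (abs_le.1 (key a b)).1; exact neg_le_iff_add_nonneg.1 this)
  simp only [hA.image_const, hB.image_const, csInf_singleton, csSup_singleton] at r1 r2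
  rw [abs_le]
  unfold Ham
  constructor <;> linarith

/-- Corollary 1.3, convergence of discrete gradients and of the Hamiltonian
along policy iteration: under the hypotheses of Theorem 1.1, for `n ≥ 1` and each `i`,
`|D_i^h(Vₙ − V)|² ≤ C_h h⁻² 2^{1−n}` and
`|L(t,x,∇^hV)(αₙ,βₙ) − H(t,x,∇^hV)|² ≤ 16 d C_h ‖f‖²_∞ h⁻² 2^{1−n}`. -/
theorem policy_iteration_gradient_and_hamiltonian_convergence
    {d m₁ m₂ : ℕ} (hd : 0 < d)
    {A : Set (Fin m₁ → ℝ)} {B : Set (Fin m₂ → ℝ)}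
    (hA : IsCompact A) (hAne : A.Nonempty) (hB : IsCompact B) (hBne : B.Nonempty)
    (c : ℝ → (Fin d → ℝ) → (Fin m₁ → ℝ) → (Fin m₂ → ℝ) → ℝ)
    (f : ℝ → (Fin d → ℝ) → (Fin m₁ → ℝ) → (Fin m₂ → ℝ) → Fin d → ℝ)
    (hc_cont : Continuous fun q : ℝ × (Fin d → ℝ) × (Fin m₁ → ℝ) × (Fin m₂ → ℝ) =>
      c q.1 q.2.1 q.2.2.1 q.2.2.2)
    (hf_cont : Continuous fun q : ℝ × (Fin d → ℝ) × (Fin m₁ → ℝ) × (Fin m₂ → ℝ) =>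
      f q.1 q.2.1 q.2.2.1 q.2.2.2)
    (Mc Mf Mg : ℝ)
    (hMc : ∀ t x a b, |c t x a b| ≤ Mc)
    (hMf : ∀ t x a b, nrm (f t x a b) ≤ Mf)
    (Sg : Fin d → ℝ → (Fin d → ℝ) → ℝ)
    (hSg_nonneg : ∀ i t x, 0 ≤ Sg i t x)
    (MS : ℝ) (hMS : ∀ i t x, Sg i t x ≤ MS)
    (g : (Fin d → ℝ) → ℝ) (hMg : ∀ x, |g x| ≤ Mg)
    (T τ h ν : ℝ) (hT : 0 < T)
    (hτ : τ ∈ Set.Ioo (0:ℝ) 1) (hh : h ∈ Set.Ioo (0:ℝ) 1)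
    (hTτ : ∃ N : ℕ, T = N * τ) (hν : 0 ≤ ν)
    (hN2a : ∀ i t x a b, h * |f t x a b i| ≤ ν + Sg i t x)
    (hN2b : ∀ t x, (d : ℝ) * ν + ∑ i, Sg i t x ≤ h ^ 2 / τ)
    (lam Lam : ℝ) (hνlam : ν ≤ lam) (hlam : 0 < lam)
    (hlow : ∀ i t x, lam ≤ Sg i t x + ν) (hupp : ∀ i t x, Sg i t x + ν ≤ Lam)
    (hN4a : ∀ i t x, (d : ℝ) * τ * Sg i t x ≤ 4 * h ^ 2)
    (hN4b : ∀ i t x, 96 * τ * max (Mc ^ 2) (2 * (d : ℝ) * Mf ^ 2) ≤ Sg i t x + ν)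
    (V : ℝ → (Fin d → ℝ) → ℝ)
    (hV_eq : ∀ t x, timeGrid τ T t → τ ≤ t → spaceGrid h x →
      dtT τ V t x + Ham A B c f t x (cgrad h (V t) x)
        = -(1/2) * ∑ i, (Sg i t x + ν) * lap1 h (V t) x i)
    (hV_T : ∀ x, spaceGrid h x → V T x = g x)
    (αn : ℕ → ℝ → (Fin d → ℝ) → (Fin m₁ → ℝ))
    (βn : ℕ → ℝ → (Fin d → ℝ) → (Fin m₂ → ℝ))
    (αnb : ℕ → (Fin m₂ → ℝ) → ℝ → (Fin d → ℝ) → (Fin m₁ → ℝ))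
    (hαA : ∀ n t x, αn n t x ∈ A) (hβB : ∀ n t x, βn n t x ∈ B)
    (hαbA : ∀ n b t x, αnb n b t x ∈ A)
    (Vn : ℕ → ℝ → (Fin d → ℝ) → ℝ)
    (hVn_eq : ∀ n t x, timeGrid τ T t → τ ≤ t → spaceGrid h x →
      dtT τ (Vn n) t x
          + Lrun c f t x (cgrad h (Vn n t) x) (αn n t x) (βn n t x)
        = -(1/2) * ∑ i, (Sg i t x + ν) * lap1 h (Vn n t) x i)
    (hVn_T : ∀ n x, spaceGrid h x → Vn n T x = g x)
    (hmin : ∀ n t x, timeGrid τ T t → spaceGrid h x → ∀ b ∈ B, ∀ a ∈ A,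
      Lrun c f t x (cgrad h (Vn n t) x) (αnb (n+1) b t x) b
        ≤ Lrun c f t x (cgrad h (Vn n t) x) a b)
    (hmax : ∀ n t x, timeGrid τ T t → spaceGrid h x → ∀ b ∈ B,
      Lrun c f t x (cgrad h (Vn n t) x) (αnb (n+1) b t x) b
        ≤ Lrun c f t x (cgrad h (Vn n t) x)
            (αnb (n+1) (βn (n+1) t x) t x) (βn (n+1) t x))
    (hsel : ∀ n t x, αn (n+1) t x = αnb (n+1) (βn (n+1) t x) t x)
    :
    ∀ n : ℕ, 1 ≤ n → ∀ t x, timeGrid τ T t → spaceGrid h x →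
      (∀ i : Fin d,
        (Dp h (fun y => Vn n t y - V t y) x i) ^ 2
          ≤ Real.exp (48 * max (Mc ^ 2) (2 * (d : ℝ) * Mf ^ 2) * T / lam)
              * (12 * Mg ^ 2 + T * lam) / h ^ 2 * (2 : ℝ) ^ (1 - (n : ℤ)))
      ∧ (Lrun c f t x (cgrad h (V t) x) (αn n t x) (βn n t x)
            - Ham A B c f t x (cgrad h (V t) x)) ^ 2
          ≤ 16 * (d : ℝ)
              * (Real.exp (48 * max (Mc ^ 2) (2 * (d : ℝ) * Mf ^ 2) * T / lam)
                  * (12 * Mg ^ 2 + T * lam))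
              * Mf ^ 2 / h ^ 2 * (2 : ℝ) ^ (1 - (n : ℤ)) := by
  obtain ⟨hτ0, hτ1⟩ := hτ
  obtain ⟨hh0, hh1⟩ := hh
  obtain ⟨N, hN⟩ := hTτ
  set M := max (Mc ^ 2) (2 * (d : ℝ) * Mf ^ 2) with hM
  have hd1 : (1:ℝ) ≤ d := by exact_mod_cast hd
  have hM1 : Mc ^ 2 ≤ M := le_max_left _ _
  have hM2 : 2 * Mf ^ 2 ≤ M := by
    refine le_trans ?_ (le_max_right _ _)
    nlinarith [sq_nonneg Mf]
  have hM0 : 0 ≤ M := (sq_nonneg _).trans hM1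
  have hMc0 : 0 ≤ Mc := (abs_nonneg _).trans (hMc 0 0 0 0)
  -- time grid
  have htg : ∀ k : ℕ, k ≤ N → timeGrid τ T (T - k * τ) := by
    intro k hk
    refine ⟨⟨N - k, ?_⟩, ?_⟩
    · rw [hN, Nat.cast_sub hk]; ring
    · have : 0 ≤ (k:ℝ) * τ := by positivity
      linarith
  have htl : ∀ k : ℕ, k < N → τ ≤ T - k * τ := by
    intro k hk
    have : ((k:ℝ) + 1) ≤ N := by exact_mod_cast hk
    rw [hN]; nlinarith
  have hti : ∀ t, timeGrid τ T t → ∃ k, k ≤ N ∧ t = T - (k:ℕ) * τ := by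
    rintro t ⟨⟨j, rfl⟩, hj⟩
    rw [hN] at hj
    have hj' : j ≤ N := by
      have := le_of_mul_le_mul_right hj hτ0
      exact_mod_cast this
    refine ⟨N - j, by omega, ?_⟩
    rw [hN, Nat.cast_sub hj']; ring
  -- coefficients
  set a : ℕ → (Fin d → ℝ) → Fin d → ℝ := fun k x i => Sg i (T - k * τ) x + ν with ha_def
  have ha : ∀ k x i, lam ≤ a k x i := fun k x i => hlow i _ x
  have ha0 : ∀ k x i, 0 ≤ a k x i := fun k x i => hlam.le.trans (ha k x i)
  have ha2 : ∀ k x i, 192 * τ * Mf ^ 2 ≤ a k x i := by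
    intro k x i
    refine le_trans ?_ (hN4b i _ x)
    have := mul_le_mul_of_nonneg_left hM2 hτ0.le
    linarith
  have hs : ∀ k x, ∑ i, τ * a k x i / h ^ 2 ≤ 1 := by
    intro k x
    have h1 := hN2b (T - k * τ) x
    have h2 : ∑ i, τ * a k x i / h ^ 2 = τ * (d * ν + ∑ i, Sg i (T - k * τ) x) / h ^ 2 := by
      rw [← Finset.sum_div, ← Finset.mul_sum, Finset.sum_add_distrib]
      simp only [Finset.sum_const, Finset.card_univ, Fintype.card_fin, nsmul_eq_mul]
      rw [add_comm]
    rw [h2, div_le_one (by positivity)]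
    rw [le_div_iff₀ hτ0] at h1
    linarith
  -- recursions
  have rec_gen : ∀ (U : ℝ → (Fin d → ℝ) → ℝ) (k : ℕ) (x : Fin d → ℝ) (F : ℝ),
      dtT τ U (T - k * τ) x + F
        = -(1/2) * ∑ i, (Sg i (T - k * τ) x + ν) * lap1 h (U (T - k * τ)) x i →
      U (T - (k + 1 : ℕ) * τ) x = EE τ h (a k x) (U (T - k * τ)) x + τ * F := by
    intro U k x F hU
    have e : T - (k + 1 : ℕ) * τ = T - k * τ - τ := by push_cast; ring
    rw [e]
    unfold dtT at hU
    unfold EE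
    have h1 : U (T - k * τ) x - U (T - k * τ - τ) x
        = τ * (-(1/2) * ∑ i, (Sg i (T - k * τ) x + ν) * lap1 h (U (T - k * τ)) x i - F) := by
      rw [← hU]; field_simp; ring
    simp only [ha_def]
    linarith
  have recV : ∀ k x, k < N → spaceGrid h x → V (T - (k + 1 : ℕ) * τ) x
      = EE τ h (a k x) (V (T - k * τ)) x
        + τ * Ham A B c f (T - k * τ) x (cgrad h (V (T - k * τ)) x) := fun k x hk hx =>
    rec_gen V k x _ (hV_eq _ x (htg k hk.le) (htl k hk) hx)
  have recVn : ∀ n k x, k < N → spaceGrid h x → Vn n (T - (k + 1 : ℕ) * τ) x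
      = EE τ h (a k x) (Vn n (T - k * τ)) x
        + τ * Lrun c f (T - k * τ) x (cgrad h (Vn n (T - k * τ)) x)
            (αn n (T - k * τ) x) (βn n (T - k * τ) x) := fun n k x hk hx =>
    rec_gen (Vn n) k x _ (hVn_eq n _ x (htg k hk.le) (htl k hk) hx)
  -- policy gap
  have gap : ∀ n t x, timeGrid τ T t → spaceGrid h x →
      (Lrun c f t x (cgrad h (V t) x) (αn (n+1) t x) (βn (n+1) t x)
        - Ham A B c f t x (cgrad h (V t) x)) ^ 2
      ≤ 4 * (Mf ^ 2 * ∑ i, (cgrad h (fun y => Vn n t y - V t y) x i) ^ 2) := by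
    intro n t x ht hx
    have hH : Ham A B c f t x (cgrad h (Vn n t) x)
        = Lrun c f t x (cgrad h (Vn n t) x) (αn (n+1) t x) (βn (n+1) t x) := by
      have hI : ∀ b ∈ B, sInf ((fun a => Lrun c f t x (cgrad h (Vn n t) x) a b) '' A)
          = Lrun c f t x (cgrad h (Vn n t) x) (αnb (n+1) b t x) b := by
        intro b hb
        refine IsLeast.csInf_eq ⟨⟨_, hαbA _ b t x, rfl⟩, ?_⟩
        rintro _ ⟨a', ha', rfl⟩
        exact hmin n t x ht hx b hb a' ha'
      unfold Ham
      refine IsGreatest.csSup_eq ⟨⟨βn (n+1) t x, hβB _ t x, ?_⟩, ?_⟩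
      · beta_reduce
        rw [hI _ (hβB _ t x), hsel]
      · rintro _ ⟨b, hb, rfl⟩
        beta_reduce
        rw [hI b hb, hsel]
        exact hmax n t x ht hx b hb
    have g1 := L_diff c f hMf t x (cgrad h (Vn n t) x) (cgrad h (V t) x)
      (αn (n+1) t x) (βn (n+1) t x)
    have g2 := Ham_diff (A := A) (B := B) hAne hBne c f hMc hMf t x
      (cgrad h (Vn n t) x) (cgrad h (V t) x)
    rw [hH] at g2
    have e : ∑ i, (cgrad h (fun y => Vn n t y - V t y) x i) ^ 2
        = ∑ i, (cgrad h (Vn n t) x i - cgrad h (V t) x i) ^ 2 := by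
      refine Finset.sum_congr rfl fun i _ => ?_
      unfold cgrad; ring
    rw [e]
    have hn : 0 ≤ Mf ^ 2 * ∑ i, (cgrad h (Vn n t) x i - cgrad h (V t) x i) ^ 2 :=
      mul_nonneg (sq_nonneg _) (Finset.sum_nonneg fun i _ => sq_nonneg _)
    have hsq := Real.sq_sqrt hn
    set D := Real.sqrt (Mf ^ 2 * ∑ i, (cgrad h (Vn n t) x i - cgrad h (V t) x i) ^ 2)
    rw [abs_le] at g1 g2
    rw [← hsq]
    nlinarith
  -- bounded data
  set v : ℕ → (Fin d → ℝ) → ℝ := fun k => V (T - k * τ) with hv_def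
  set vn : ℕ → ℕ → (Fin d → ℝ) → ℝ := fun n k => Vn n (T - k * τ) with hvn_def
  set w : ℕ → ℕ → (Fin d → ℝ) → ℝ := fun n k y => vn n k y - v k y with hw_def
  have g2 : ∀ x, g x ^ 2 ≤ Mg ^ 2 := fun x => by
    rw [← sq_abs]; exact pow_le_pow_left₀ (abs_nonneg _) (hMg x) 2
  have bV := basic_bound (N := N) (Mg := Mg) hτ0 hh0 hlam hM1 hM2 a ha ha2 hs v
    (by intro x hx; simp only [hv_def]; rw [Nat.cast_zero, zero_mul, sub_zero, hV_T x hx]; exact g2 x)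
    (by
      intro k x hk hx
      have hb := Ham_abs (A := A) (B := B) hAne hBne c f hMc hMf (T - k * τ) x (cgrad h (v k) x)
      obtain ⟨F1, F2, e, b1, b2⟩ := split_abs (Real.sqrt_nonneg _) hb
      refine ⟨F1, F2, ?_, ?_, b2⟩
      · rw [← e]; exact recV k x hk hx
      · rwa [Real.sq_sqrt] at b1
        exact mul_nonneg (sq_nonneg _) (Finset.sum_nonneg fun i _ => sq_nonneg _))
  have bV0 := basic_bound (N := N) (Mg := Mg) hτ0 hh0 hlam hM1 hM2 a ha ha2 hs (vn 0)
    (by intro x hx; simp only [hvn_def]; rw [Nat.cast_zero, zero_mul, sub_zero, hVn_T 0 x hx]; exact g2 x)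
    (by
      intro k x hk hx
      have hb := L_abs c f hMc hMf (T - k * τ) x (cgrad h (vn 0 k) x)
        (αn 0 (T - k * τ) x) (βn 0 (T - k * τ) x)
      obtain ⟨F1, F2, e, b1, b2⟩ := split_abs (Real.sqrt_nonneg _) hb
      refine ⟨F1, F2, ?_, ?_, b2⟩
      · rw [← e]; exact recVn 0 k x hk hx
      · rwa [Real.sq_sqrt] at b1
        exact mul_nonneg (sq_nonneg _) (Finset.sum_nonneg fun i _ => sq_nonneg _))
  have bstep : ∀ n, _ := fun n => step_bound (N := N) hτ0 hh0 hlam hM2 a ha ha2 hs (w (n+1)) (w n)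
    (by
      intro x hx
      simp only [hw_def, hvn_def, hv_def]
      rw [Nat.cast_zero, zero_mul, sub_zero, hVn_T _ x hx, hV_T x hx, sub_self])
    (by
      intro k x hk hx
      refine ⟨Lrun c f (T - k * τ) x (cgrad h (vn (n+1) k) x)
          (αn (n+1) (T - k * τ) x) (βn (n+1) (T - k * τ) x)
        - Lrun c f (T - k * τ) x (cgrad h (v k) x)
          (αn (n+1) (T - k * τ) x) (βn (n+1) (T - k * τ) x),
        _, ?_, ?_, gap n (T - k * τ) x (htg k hk.le) hx⟩
      · have r1 := recVn (n+1) k x hk hx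
        have r2 := recV k x hk hx
        have r3 := EE_add τ h (a k x) (vn (n+1) k) (v k) 1 (-1) x
        have r4 : (fun y => 1 * vn (n+1) k y + (-1) * v k y) = w (n+1) k := by
          funext y; simp only [hw_def]; ring
        rw [r4] at r3
        have r5 : w (n+1) (k+1) x = Vn (n+1) (T - (k+1:ℕ) * τ) x - V (T - (k+1:ℕ) * τ) x := rfl
        rw [r5, r1, r2, r3]
        simp only [hvn_def, hv_def]
        ring
      · have g1 := L_diff c f hMf (T - k * τ) x (cgrad h (vn (n+1) k) x) (cgrad h (v k) x)
          (αn (n+1) (T - k * τ) x) (βn (n+1) (T - k * τ) x)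
        have e : ∑ i, (cgrad h (w (n+1) k) x i) ^ 2
            = ∑ i, (cgrad h (vn (n+1) k) x i - cgrad h (v k) x i) ^ 2 := by
          refine Finset.sum_congr rfl fun i _ => ?_
          simp only [cgrad, hw_def]; ring
        rw [e]
        have g3 := pow_le_pow_left₀ (abs_nonneg _) g1 2
        rwa [sq_abs, Real.sq_sqrt] at g3
        exact mul_nonneg (sq_nonneg _) (Finset.sum_nonneg fun i _ => sq_nonneg _))
  have hC0 : 0 ≤ τ * (24 * M / lam) := by positivity
  set CC := Real.exp (48 * M * T / lam) * (12 * Mg ^ 2 + T * lam) with hCC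
  have hCC0 : 0 ≤ CC := by positivity
  have hS0 : ∀ k, k ≤ N → ∀ x, spaceGrid h x →
      5 / 4 * SS τ h (τ * (24 * M / lam)) a (w 0) k x ≤ CC ∧ w 0 k x ^ 2 ≤ CC / 2 := by
    intro k hk x hx
    have c1 := const_bound (Mg := Mg) hτ0 hlam hk hN hT hM1
    have c2 := bV k hk x hx
    have c3 := bV0 k hk x hx
    have c4 := SS_sub (N := N) hτ0 hh0 hC0 a ha0 hs (vn 0) v k hk x hx
    have c5 := SS_nonneg (N := N) hτ0 hh0 hC0 a ha0 hs (vn 0) k hk x hx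
    have c6 := SS_nonneg (N := N) hτ0 hh0 hC0 a ha0 hs v k hk x hx
    change SS τ h (τ * (24 * M / lam)) a (w 0) k x ≤ _ at c4
    have c7 : w 0 k x = vn 0 k x - v k x := rfl
    rw [← hCC] at c1
    constructor
    · nlinarith [sq_nonneg (vn 0 k x), sq_nonneg (v k x)]
    · rw [c7]; nlinarith [sq_nonneg (vn 0 k x + v k x)]
  have hSn : ∀ n k, k ≤ N → ∀ x, spaceGrid h x →
      SS τ h (τ * (24 * M / lam)) a (w n) k x * 2 ^ n
        ≤ SS τ h (τ * (24 * M / lam)) a (w 0) k x := by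
    intro n
    induction n with
    | zero => intro k _ x _; simp
    | succ n ih =>
      intro k hk x hx
      have h1 := bstep n k hk x hx
      have h2 := ih k hk x hx
      have h3 : SS τ h (τ * (24 * M / lam)) a (w (n+1)) k x * 2
          ≤ SS τ h (τ * (24 * M / lam)) a (w n) k x := by nlinarith [sq_nonneg (w (n+1) k x)]
      have h4 := mul_le_mul_of_nonneg_right h3 (by positivity : (0:ℝ) ≤ 2 ^ n)
      rw [pow_succ]; linarith
  have hw : ∀ n k, k ≤ N → ∀ x, spaceGrid h x →
      w n k x ^ 2 ≤ CC / 4 * (2:ℝ) ^ (1 - (n:ℤ)) := by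
    intro n k hk x hx
    obtain ⟨s1, s2⟩ := hS0 k hk x hx
    cases n with
    | zero => simp; linarith
    | succ n =>
      have h1 := bstep n k hk x hx
      have h2 := hSn n k hk x hx
      have h3 := SS_nonneg (N := N) hτ0 hh0 hC0 a ha0 hs (w (n+1)) k hk x hx
      have e : (2:ℝ) ^ (1 - ((n+1:ℕ):ℤ)) = ((2:ℝ) ^ n)⁻¹ := by
        rw [← zpow_natCast, ← zpow_neg]; congr 1; push_cast; ring
      rw [e, ← div_eq_mul_inv, le_div_iff₀ (by positivity)]
      have h4 : w (n+1) k x ^ 2 ≤ 5 / 16 * SS τ h (τ * (24 * M / lam)) a (w n) k x := by linarith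
      have h5 := mul_le_mul_of_nonneg_right h4 (by positivity : (0:ℝ) ≤ 2 ^ n)
      linarith
  -- conclusion
  have hdiff : ∀ {p q r K : ℝ}, p ^ 2 ≤ K → q ^ 2 ≤ K → (p - q) ^ 2 ≤ 4 * K := by
    intro p q r K hp hq
    nlinarith [sq_nonneg (p + q)]
  intro n hn t x ht hx
  obtain ⟨k, hk, rfl⟩ := hti t ht
  constructor
  · intro i
    have h1 := hw n k hk _ (spaceGrid_up hx i)
    have h2 := hw n k hk x hx
    have h3 := hdiff (r := 0) h1 h2
    have e : Dp h (fun y => Vn n (T - k * τ) y - V (T - k * τ) y) x i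
        = (w n k (Function.update x i (x i + h)) - w n k x) / h := rfl
    rw [e, div_pow, div_mul_eq_mul_div]
    exact div_le_div_of_nonneg_right (by linarith) (by positivity)
  · obtain ⟨m, rfl⟩ : ∃ m, n = m + 1 := ⟨n - 1, by omega⟩
    refine (gap m _ x ht hx).trans ?_
    have e : (2:ℝ) ^ (1 - (m:ℤ)) = 2 * (2:ℝ) ^ (1 - ((m+1:ℕ):ℤ)) := by
      rw [← zpow_one_add₀ (by norm_num)]; congr 1; push_cast; ring
    set E := (2:ℝ) ^ (1 - ((m+1:ℕ):ℤ)) with hE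
    have hE0 : 0 ≤ E := by positivity
    have hi : ∀ i, (cgrad h (fun y => Vn m (T - k * τ) y - V (T - k * τ) y) x i) ^ 2
        ≤ CC * E / h ^ 2 := by
      intro i
      have h1 := hw m k hk _ (spaceGrid_up hx i)
      have h2 := hw m k hk _ (spaceGrid_dn hx i)
      have h3 := hdiff (r := 0) h1 h2
      have e2 : cgrad h (fun y => Vn m (T - k * τ) y - V (T - k * τ) y) x i
          = (w m k (Function.update x i (x i + h)) - w m k (Function.update x i (x i - h)))
            / (2 * h) := rfl
      rw [e2, div_pow, div_le_div_iff₀ (by positivity) (by positivity)]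
      rw [e] at h3
      have := mul_le_mul_of_nonneg_right h3 (sq_nonneg h)
      have p0 : 0 ≤ CC * E * h ^ 2 := by positivity
      linarith
    have hsum : ∑ i, (cgrad h (fun y => Vn m (T - k * τ) y - V (T - k * τ) y) x i) ^ 2
        ≤ d * (CC * E / h ^ 2) := by
      refine (Finset.sum_le_sum fun i _ => hi i).trans (le_of_eq ?_)
      simp
    have h5 := mul_le_mul_of_nonneg_left hsum (sq_nonneg Mf)
    have p0 : 0 ≤ Mf ^ 2 * (d * (CC * E / h ^ 2)) := by positivity
    have e3 : 16 * (d:ℝ) * CC * Mf ^ 2 / h ^ 2 * E = 16 * (Mf ^ 2 * (d * (CC * E / h ^ 2))) := by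
      ring
    rw [e3]
    linarith
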